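/- Let $k$ be a field of characteristic $p > 0$ and $K = k((X))$ the field of formal Laurent series. If $g \in K$ is such that $g - g^p$ is supported in nonpositive degrees (i.e. the coefficient of $X^n$ in $g - g^p$ vanishes for all $n > 0$), then $g$ itself is supported in nonpositive degrees. -/

import Mathlib

/-- The product of two Laurent series supported in nonpositive degrees is supported in
nonpositive degrees. -/
theorem LaurentSeries.coeff_mul_eq_zero_of_pos {R : Type*} [Semiring R] {x y : LaurentSeries R}
    (hx : ∀ n : ℤ, 0 < n → x.coeff n = 0) (hy : ∀ n : ℤ, 0 < n → y.coeff n = 0) :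
    ∀ n : ℤ, 0 < n → (x * y).coeff n = 0 := by
  intro n hn
  rw [HahnSeries.coeff_mul]
  refine Finset.sum_eq_zero fun ij hij => ?_
  obtain ⟨-, -, hsum⟩ := Finset.mem_antidiagonal.mp hij
  rcases lt_or_ge 0 ij.1 with h1 | h1
  · rw [hx _ h1, zero_mul]
  · rw [hy _ (by omega), mul_zero]

/-- Powers of a Laurent series supported in nonpositive degrees are supported in
nonpositive degrees. -/
theorem LaurentSeries.coeff_pow_eq_zero_of_pos {R : Type*} [Semiring R] {x : LaurentSeries R}
    (hx : ∀ n : ℤ, 0 < n → x.coeff n = 0) (m : ℕ) :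
    ∀ n : ℤ, 0 < n → (x ^ m).coeff n = 0 := by
  induction m with
  | zero =>
    intro n hn
    rw [pow_zero, HahnSeries.coeff_one, if_neg hn.ne']
  | succ m ih =>
    rw [pow_succ]
    exact coeff_mul_eq_zero_of_pos ih hx

/-- Let `k` be a field of characteristic `p > 0` and `K = k((X))` the field
of formal Laurent series.  If `g ∈ K` is such that `g - g^p` is supported in nonpositive
degrees, then `g` itself is supported in nonpositive degrees. -/
theorem stmt_7 (k : Type*) [Field k] (p : ℕ) [Fact p.Prime] [CharP k p]
    (g : LaurentSeries k) (h : ∀ n : ℤ, 0 < n → (g - g ^ p).coeff n = 0) :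
    ∀ n : ℤ, 0 < n → g.coeff n = 0 := by
  have : CharP (LaurentSeries k) p :=
    charP_of_injective_ringHom (HahnSeries.C_injective (Γ := ℤ) (R := k)) p
  set a : LaurentSeries k := HahnSeries.truncLT 1 g with ha
  have ha0 : ∀ n : ℤ, 0 < n → a.coeff n = 0 := fun n hn =>
    HahnSeries.coeff_truncLT_of_le (by omega) g
  set b : LaurentSeries k := g - a with hb
  have hb0 : ∀ n : ℤ, n ≤ 0 → b.coeff n = 0 := fun n hn => by
    rw [hb, HahnSeries.coeff_sub, ha, HahnSeries.coeff_truncLT_of_lt (by omega), sub_self]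
  suffices hbz : b = 0 by
    rwa [sub_eq_zero.mp hbz]
  by_contra hne
  have hpos : 0 < b.order := by
    by_contra! hle
    exact HahnSeries.coeff_order_eq_zero.not.mpr hne (hb0 _ hle)
  have hlt : b.order < (b ^ p).order := by
    rw [HahnSeries.order_pow, nsmul_eq_mul]
    have : (2 : ℤ) ≤ p := by exact_mod_cast (Fact.out : p.Prime).two_le
    nlinarith
  have hdecomp : b = (g - g ^ p) - a + a ^ p + b ^ p := by
    rw [hb, sub_pow_char]
    ring
  refine HahnSeries.coeff_order_eq_zero.not.mpr hne ?_
  conv_lhs => arg 1; rw [hdecomp]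
  rw [HahnSeries.coeff_add, HahnSeries.coeff_add, HahnSeries.coeff_sub, h _ hpos, ha0 _ hpos,
    LaurentSeries.coeff_pow_eq_zero_of_pos ha0 p _ hpos,
    HahnSeries.coeff_eq_zero_of_lt_order hlt]
  simp
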